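/- For every integer k ≥ 2 there exists an Eulerian plane triangulation T_k of order n = 24k whose connected domination number satisfies γ_c(T_k) ≥ 3n/8 − 1 = 9k − 1. In particular, there is an infinite family of plane triangulations G with γ_c(G) ≥ 3|V(G)|/8 − 1, so it is false that every plane triangulation of order n has connected domination number at most n/3. -/

import Mathlib

/-- A drawing (embedding) of a simple graph in the plane `ℝ × ℝ` without crossings:
vertices are mapped to distinct points, each edge to an injective arc joining its
endpoints, arcs pass through no other vertex, and two arcs of distinct edges meet
only in common endpoints. -/
structure PlaneEmbedding {V : Type} (G : SimpleGraph V) where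
  vtx : V → ℝ × ℝ
  vtx_inj : Function.Injective vtx
  arc : ∀ ⦃u v : V⦄, G.Adj u v → Set (ℝ × ℝ)
  arc_symm : ∀ ⦃u v : V⦄ (h : G.Adj u v), arc h.symm = arc h
  arc_path : ∀ ⦃u v : V⦄ (h : G.Adj u v),
    ∃ γ : Path (vtx u) (vtx v), Function.Injective ⇑γ ∧ Set.range ⇑γ = arc h
  arc_vtx : ∀ ⦃u v : V⦄ (h : G.Adj u v) (w : V), vtx w ∈ arc h → w = u ∨ w = v
  arc_inter : ∀ ⦃u v a b : V⦄ (h₁ : G.Adj u v) (h₂ : G.Adj a b), s(u, v) ≠ s(a, b) →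
    arc h₁ ∩ arc h₂ ⊆ ({vtx u, vtx v} : Set (ℝ × ℝ)) ∩ {vtx a, vtx b}

namespace PlaneEmbedding

variable {V : Type} {G : SimpleGraph V}

/-- The point set of the sub-drawing determined by the vertices in `S`
(the inherited embedding of the induced subgraph on `S`). -/
def subSupport (E : PlaneEmbedding G) (S : Set V) : Set (ℝ × ℝ) :=
  E.vtx '' S ∪ ⋃ (u : V) (_ : u ∈ S) (v : V) (_ : v ∈ S) (h : G.Adj u v), E.arc h

/-- The induced subgraph on `S`, with the inherited embedding, is an outerplane graph:
every vertex of `S` lies on the boundary of the outer (unbounded) face, i.e. in the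
closure of the set of points belonging to unbounded faces of the sub-drawing. -/
def OuterplaneOn (E : PlaneEmbedding G) (S : Set V) : Prop :=
  ∀ v ∈ S, E.vtx v ∈ closure {p | p ∉ E.subSupport S ∧
    ¬ Bornology.IsBounded (connectedComponentIn (E.subSupport S)ᶜ p)}

/-- The whole drawing is an outerplane graph. -/
def IsOuterplane (E : PlaneEmbedding G) : Prop := E.OuterplaneOn Set.univ

end PlaneEmbedding

/-- A graph is planar if it admits a plane embedding. -/
def IsPlanar {V : Type} (G : SimpleGraph V) : Prop := Nonempty (PlaneEmbedding G)

/-- A graph is outerplanar if it admits a plane embedding with all vertices on the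
boundary of the outer face. -/
def IsOuterplanar {V : Type} (G : SimpleGraph V) : Prop :=
  ∃ E : PlaneEmbedding G, E.IsOuterplane

/-- A plane triangulation is an edge-maximal (finite) planar graph. -/
def IsPlaneTriangulation {V : Type} (G : SimpleGraph V) : Prop :=
  IsPlanar G ∧ ∀ u v : V, u ≠ v → ¬ G.Adj u v →
    ¬ IsPlanar (G ⊔ SimpleGraph.fromEdgeSet {s(u, v)})

/-- `G` has a `K_m`-minor: there are `m` pairwise disjoint nonempty connected branch
sets with an edge between any two of them. -/
def HasCliqueMinor {V : Type} (G : SimpleGraph V) (m : ℕ) : Prop :=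
  ∃ B : Fin m → Set V,
    (∀ i, (B i).Nonempty) ∧
    (∀ i, (G.induce (B i)).Connected) ∧
    (∀ i j, i ≠ j → Disjoint (B i) (B j)) ∧
    (∀ i j, i ≠ j → ∃ u ∈ B i, ∃ v ∈ B j, G.Adj u v)

/-- `G` is `K₄`-minor free. -/
def K4MinorFree {V : Type} (G : SimpleGraph V) : Prop := ¬ HasCliqueMinor G 4

/-- `s_{o'}(G)` for a fixed plane embedding of `G`: the maximum order of an induced
subgraph whose inherited embedding is an outerplane graph. -/
noncomputable def sO' {V : Type} [Fintype V] {G : SimpleGraph V}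
    (E : PlaneEmbedding G) : ℕ :=
  sSup {n | ∃ S : Finset V, E.OuterplaneOn ↑S ∧ S.card = n}

/-- `s_o(G)`: the maximum order of an induced outerplanar subgraph of `G`. -/
noncomputable def sO {V : Type} [Fintype V] (G : SimpleGraph V) : ℕ :=
  sSup {n | ∃ S : Finset V, IsOuterplanar (G.induce (↑S : Set V)) ∧ S.card = n}

/-- `s_{K₄}(G)`: the maximum order of an induced `K₄`-minor-free subgraph of `G`. -/
noncomputable def sK4 {V : Type} [Fintype V] (G : SimpleGraph V) : ℕ :=
  sSup {n | ∃ S : Finset V, K4MinorFree (G.induce (↑S : Set V)) ∧ S.card = n}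

/-- `tw(G) ≤ k`: `G` admits a tree decomposition of width at most `k`. -/
def TreewidthLE {V : Type} (G : SimpleGraph V) (k : ℕ) : Prop :=
  ∃ (ι : Type) (T : SimpleGraph ι) (bag : ι → Set V),
    T.IsTree ∧
    (∀ v : V, ∃ i, v ∈ bag i) ∧
    (∀ u v : V, G.Adj u v → ∃ i, u ∈ bag i ∧ v ∈ bag i) ∧
    (∀ v : V, (T.induce {i | v ∈ bag i}).Connected) ∧
    (∀ i, (bag i).ncard ≤ k + 1)

/-- `G` is a `k`-tree: its vertices admit a construction order in which the first
`k+1` vertices form a complete graph and every later vertex is joined to exactly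
`k` earlier, pairwise adjacent, vertices. -/
def IsKTree (k : ℕ) {V : Type} (G : SimpleGraph V) : Prop :=
  ∃ (n : ℕ) (e : Fin n ≃ V), k + 1 ≤ n ∧
    (∀ i j : Fin n, (i : ℕ) < k + 1 → (j : ℕ) < k + 1 → i ≠ j → G.Adj (e i) (e j)) ∧
    (∀ j : Fin n, k + 1 ≤ (j : ℕ) →
      {i : Fin n | i < j ∧ G.Adj (e i) (e j)}.ncard = k ∧
      (∀ i i' : Fin n, i < j → i' < j → G.Adj (e i) (e j) → G.Adj (e i') (e j) →
        i ≠ i' → G.Adj (e i) (e i')))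

/-- `S` is a dominating set of `G`. -/
def IsDomSet {V : Type} (G : SimpleGraph V) (S : Set V) : Prop :=
  ∀ v : V, v ∈ S ∨ ∃ u ∈ S, G.Adj u v

/-- `S` is a connected dominating set of `G`. -/
def IsConnDomSet {V : Type} (G : SimpleGraph V) (S : Set V) : Prop :=
  IsDomSet G S ∧ (G.induce S).Connected

/-- The domination number `γ(G)`. -/
noncomputable def domNum {V : Type} [Fintype V] (G : SimpleGraph V) : ℕ :=
  sInf {n | ∃ S : Finset V, IsDomSet G ↑S ∧ S.card = n}

/-- The connected domination number `γ_c(G)`. -/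
noncomputable def connDomNum {V : Type} [Fintype V] (G : SimpleGraph V) : ℕ :=
  sInf {n | ∃ S : Finset V, IsConnDomSet G ↑S ∧ S.card = n}

/-- A graph is Eulerian if every vertex has even degree. -/
def IsEulerian {V : Type} (G : SimpleGraph V) : Prop :=
  ∀ v : V, Even (G.neighborSet v).ncard

/-- `G` contains a subgraph isomorphic to `H`. -/
def ContainsCopy {W V : Type} (H : SimpleGraph W) (G : SimpleGraph V) : Prop :=
  ∃ f : H →g G, Function.Injective ⇑f

/-- The complete tripartite graph `K_{1,1,3}`. -/
def K113 : SimpleGraph (Fin 5) :=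
  SimpleGraph.fromEdgeSet {s(0, 1), s(0, 2), s(0, 3), s(0, 4), s(1, 2), s(1, 3), s(1, 4)}

/-- `G` is a maximal outerplanar graph. -/
def IsMaximalOuterplanar {V : Type} (G : SimpleGraph V) : Prop :=
  IsOuterplanar G ∧ ∀ u v : V, u ≠ v → ¬ G.Adj u v →
    ¬ IsOuterplanar (G ⊔ SimpleGraph.fromEdgeSet {s(u, v)})

/-! ### Logarithmic increments of paths in the punctured plane -/

section LogIncrement

open unitInterval

/-- `d` is the increment, over the unit interval, of a continuous logarithm of `f`. -/
def IsLogIncrement (f : I → ℂ) (d : ℂ) : Prop :=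
  ∃ L : I → ℂ, Continuous L ∧ (∀ t, Complex.exp (L t) = f t) ∧ d = L 1 - L 0

theorem exists_continuous_log {A : Type} [TopologicalSpace A] [SimplyConnectedSpace A]
    [LocallyPathConnectedSpace A] [Inhabited A] (f : A → ℂ) (hf : Continuous f)
    (h0 : ∀ a, f a ≠ 0) :
    ∃ L : A → ℂ, Continuous L ∧ ∀ a, Complex.exp (L a) = f a := by
  obtain ⟨F, ⟨-, hF⟩, -⟩ := Complex.isCoveringMapOn_exp.existsUnique_continuousMap_lifts
    (⟨f, hf⟩ : C(A, ℂ)) (a₀ := default) (e₀ := Complex.log (f default))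
    (Complex.exp_log (h0 _)) h0
  exact ⟨F, F.continuous, fun a => congrFun hF a⟩

theorem IsLogIncrement.unique {f : I → ℂ} {d e : ℂ} (hd : IsLogIncrement f d)
    (he : IsLogIncrement f e) : d = e := by
  obtain ⟨L, hL, hLf, rfl⟩ := hd
  obtain ⟨M, hM, hMf, rfl⟩ := he
  have key := Complex.isCoveringMap_exp.const_of_comp (g := fun t => L t - M t)
    (hL.sub hM) (by
      intro a b
      apply Subtype.ext
      have h : ∀ t, Complex.exp (L t - M t) = 1 := fun t => by
        rw [Complex.exp_sub, hLf, hMf, div_self]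
        rw [← hLf]; exact Complex.exp_ne_zero _
      simp only [h]) 1 0
  linear_combination key

theorem IsLogIncrement.exp_eq {f : I → ℂ} {d : ℂ} (hd : IsLogIncrement f d) :
    Complex.exp d = f 1 / f 0 := by
  obtain ⟨L, -, hLf, rfl⟩ := hd
  rw [Complex.exp_sub, hLf, hLf]

theorem IsLogIncrement.neg {f : I → ℂ} {d : ℂ} (hd : IsLogIncrement f d) :
    IsLogIncrement (fun t => -f t) d := by
  obtain ⟨L, hL, hLf, rfl⟩ := hd
  refine ⟨fun t => L t + Real.pi * Complex.I, by fun_prop, fun t => ?_, by ring⟩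
  rw [Complex.exp_add, hLf, Complex.exp_pi_mul_I, mul_neg_one]

theorem exists_isLogIncrement (f : I → ℂ) (hf : Continuous f) (h0 : ∀ t, f t ≠ 0) :
    ∃ d, IsLogIncrement f d := by
  obtain ⟨L, hL, hLf⟩ := exists_continuous_log (fun x : ℝ => f (Set.projIcc 0 1 zero_le_one x))
    (hf.comp continuous_projIcc) (fun _ => h0 _)
  exact ⟨_, fun t => L t, by fun_prop, fun t => by simp [hLf], rfl⟩

/-- The four boundary increments of `γ s - δ t` over the unit square cancel. -/
theorem logIncrement_square {γ δ : I → ℂ} (hγ : Continuous γ) (hδ : Continuous δ)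
    (hne : ∀ s t, γ s ≠ δ t) {p q r w : ℂ}
    (hp : IsLogIncrement (fun s => γ s - δ 1) p) (hq : IsLogIncrement (fun s => γ s - δ 0) q)
    (hr : IsLogIncrement (fun t => δ t - γ 1) r) (hw : IsLogIncrement (fun t => δ t - γ 0) w) :
    p - q = r - w := by
  obtain ⟨L', hL', hLf'⟩ := exists_continuous_log (A := ℝ × ℝ)
    (fun x => γ (Set.projIcc 0 1 zero_le_one x.1) - δ (Set.projIcc 0 1 zero_le_one x.2))
    ((hγ.comp (continuous_projIcc.comp continuous_fst)).sub
      (hδ.comp (continuous_projIcc.comp continuous_snd))) (fun x => sub_ne_zero.2 (hne _ _))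
  obtain ⟨L, hL, hLf⟩ : ∃ L : I × I → ℂ, Continuous L ∧
      ∀ x, Complex.exp (L x) = γ x.1 - δ x.2 :=
    ⟨fun x => L' (x.1, x.2), by fun_prop, fun x => by simp [hLf']⟩
  have e1 := hp.unique ⟨fun s => L (s, 1), by fun_prop, fun s => hLf _, rfl⟩
  have e2 := hq.unique ⟨fun s => L (s, 0), by fun_prop, fun s => hLf _, rfl⟩
  have e3 := hr.neg.unique ⟨fun t => L (1, t), by fun_prop, fun t => by simp [hLf], rfl⟩
  have e4 := hw.neg.unique ⟨fun t => L (0, t), by fun_prop, fun t => by simp [hLf], rfl⟩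
  linear_combination e1 - e2 - e3 + e4

end LogIncrement

/-! ### Winding systems and the separation property of wheels -/

/-- Numbers `θ a b v` behaving like the change of `log (x - z v)` as `x` runs along the
edge `ab` of a plane drawing with vertex positions `z`. -/
structure IsWindingSystem {V : Type} (G : SimpleGraph V) (z : V → ℂ) (θ : V → V → V → ℂ) :
    Prop where
  inj : Function.Injective z
  exp_eq : ∀ ⦃a b v : V⦄, G.Adj a b → v ≠ a → v ≠ b →
    Complex.exp (θ a b v) = (z b - z v) / (z a - z v)
  symm : ∀ ⦃a b : V⦄ (v : V), a ≠ b → θ b a v = -θ a b v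
  square : ∀ ⦃a b c d : V⦄, G.Adj a b → G.Adj c d → a ≠ c → a ≠ d → b ≠ c → b ≠ d →
    θ a b d - θ a b c = θ c d b - θ c d a

theorem PlaneEmbedding.exists_isWindingSystem {V : Type} {G : SimpleGraph V}
    (E : PlaneEmbedding G) : ∃ z θ, IsWindingSystem G z θ := by
  classical
  choose γ _ hγ using E.arc_path
  let φ := Complex.equivRealProdCLM.symm
  have hmem : ∀ ⦃a b : V⦄ (h : G.Adj a b) t, γ h t ∈ E.arc h := fun a b h t => by
    rw [← hγ h]; exact ⟨t, rfl⟩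
  have hinc : ∀ a b v : V, ∃ d : ℂ, ∀ h : G.Adj a b, v ≠ a → v ≠ b →
      IsLogIncrement (fun t => φ (γ h t) - φ (E.vtx v)) d := by
    intro a b v
    by_cases hh : G.Adj a b ∧ v ≠ a ∧ v ≠ b
    · obtain ⟨h, hva, hvb⟩ := hh
      obtain ⟨d, hd⟩ := exists_isLogIncrement (fun t => φ (γ h t) - φ (E.vtx v))
        (by have := (γ h).continuous; fun_prop) (fun t ht => by
          have h1 : γ h t = E.vtx v := φ.injective (sub_eq_zero.1 ht)
          have h2 := hmem h t
          rw [h1] at h2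
          rcases E.arc_vtx h v h2 with h3 | h3
          · exact hva h3
          · exact hvb h3)
      exact ⟨d, fun _ _ _ => hd⟩
    · exact ⟨0, fun h h1 h2 => absurd ⟨h, h1, h2⟩ hh⟩
  choose τ hτ using hinc
  have hexp : ∀ ⦃a b v : V⦄, G.Adj a b → v ≠ a → v ≠ b →
      Complex.exp (τ a b v) = (φ (E.vtx b) - φ (E.vtx v)) / (φ (E.vtx a) - φ (E.vtx v)) := by
    intro a b v h h1 h2
    rw [(hτ a b v h h1 h2).exp_eq]
    simp
  have hsq : ∀ ⦃a b c d : V⦄, G.Adj a b → G.Adj c d → a ≠ c → a ≠ d → b ≠ c → b ≠ d →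
      τ a b d - τ a b c = τ c d b - τ c d a := by
    intro a b c d h1 h2 hac had hbc hbd
    have hp := hτ a b d h1 had.symm hbd.symm
    have hq := hτ a b c h1 hac.symm hbc.symm
    have hr := hτ c d b h2 hbc hbd
    have hw := hτ c d a h2 hac had
    refine logIncrement_square (γ := fun s => φ (γ h1 s)) (δ := fun s => φ (γ h2 s))
      (by have := (γ h1).continuous; fun_prop) (by have := (γ h2).continuous; fun_prop)
      (fun s t hst => ?_) (by simpa using hp) (by simpa using hq) (by simpa using hr)
      (by simpa using hw)
    have hst' : γ h1 s = γ h2 t := φ.injective hst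
    have hs : s(a, b) ≠ s(c, d) := by
      intro h
      rcases Sym2.eq_iff.1 h with ⟨h, -⟩ | ⟨h, -⟩
      · exact hac h
      · exact had h
    have hin := E.arc_inter h1 h2 hs ⟨hmem h1 s, hst' ▸ hmem h2 t⟩
    obtain ⟨e1 | e1, e2 | e2⟩ := hin <;> have e := E.vtx_inj (e1.symm.trans e2)
    · exact hac e
    · exact had e
    · exact hbc e
    · exact hbd e
  let _ : LinearOrder V := linearOrderOfSTO WellOrderingRel
  refine ⟨fun v => φ (E.vtx v), fun a b v => if a < b then τ a b v else -τ b a v,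
    φ.injective.comp E.vtx_inj, ?_, ?_, ?_⟩
  · intro a b v h h1 h2
    split_ifs
    · exact hexp h h1 h2
    · rw [Complex.exp_neg, hexp h.symm h2 h1, inv_div]
  · intro a b v hab
    rcases lt_or_gt_of_ne hab with h | h
    · simp [h, h.not_gt]
    · simp [h, h.not_gt]
  · intro a b c d h1 h2 hac had hbc hbd
    split_ifs
    · exact hsq h1 h2 hac had hbc hbd
    · linear_combination -hsq h1 h2.symm had hac hbd hbc
    · linear_combination -hsq h1.symm h2 hbc hbd hac had
    · linear_combination hsq h1.symm h2.symm hbd hbc had hac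

namespace IsWindingSystem

variable {V : Type} {G : SimpleGraph V} {z : V → ℂ} {θ : V → V → V → ℂ}

theorem exp_sum (hθ : IsWindingSystem G z θ) {c : ℕ → V} {x : V} {p q : ℕ} (hpq : p ≤ q)
    (hadj : ∀ i, p ≤ i → i < q → G.Adj (c i) (c (i + 1)))
    (hx : ∀ i, p ≤ i → i ≤ q → x ≠ c i) :
    Complex.exp (∑ i ∈ Finset.Ico p q, θ (c i) (c (i + 1)) x) =
      (z (c q) - z x) / (z (c p) - z x) := by
  have hne : ∀ i, p ≤ i → i ≤ q → z (c i) - z x ≠ 0 := fun i h1 h2 =>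
    sub_ne_zero.2 fun h => hx i h1 h2 (hθ.inj h).symm
  induction q, hpq using Nat.le_induction with
  | base => simp [div_self (hne p le_rfl le_rfl)]
  | succ q hpq ih =>
    rw [Finset.sum_Ico_succ_top hpq, Complex.exp_add,
      ih (fun i h1 h2 => hadj i h1 (by omega)) (fun i h1 h2 => hx i h1 (by omega))
        (fun i h1 h2 => hne i h1 (by omega)),
      hθ.exp_eq (hadj q hpq (by omega)) (hx q hpq (by omega)) (hx (q + 1) (by omega) le_rfl)]
    have h1 := hne q hpq (by omega)
    have h2 := hne p le_rfl (by omega)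
    field_simp

/-- Along a walk avoiding the edge `ab`, the square relations telescope. -/
theorem sum_square (hθ : IsWindingSystem G z θ) {c : ℕ → V} {a b : V} {p q : ℕ} (hpq : p ≤ q)
    (hab : G.Adj a b) (hadj : ∀ i, p ≤ i → i < q → G.Adj (c i) (c (i + 1)))
    (ha : ∀ i, p ≤ i → i ≤ q → a ≠ c i) (hb : ∀ i, p ≤ i → i ≤ q → b ≠ c i) :
    θ a b (c q) - θ a b (c p) = ∑ i ∈ Finset.Ico p q, θ (c i) (c (i + 1)) b
      - ∑ i ∈ Finset.Ico p q, θ (c i) (c (i + 1)) a := by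
  induction q, hpq using Nat.le_induction with
  | base => simp
  | succ q hpq ih =>
    rw [Finset.sum_Ico_succ_top hpq, Finset.sum_Ico_succ_top hpq]
    linear_combination ih (fun i h1 h2 => hadj i h1 (by omega))
        (fun i h1 h2 => ha i h1 (by omega)) (fun i h1 h2 => hb i h1 (by omega)) +
      hθ.square hab (hadj q hpq (by omega)) (ha q hpq (by omega)) (ha (q + 1) (by omega) le_rfl)
        (hb q hpq (by omega)) (hb (q + 1) (by omega) le_rfl)

/-- The increment around the triangle `a u b`, seen from `x`, takes the same value at
adjacent vertices off the triangle. -/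
theorem triangle_eq (hθ : IsWindingSystem G z θ) {a u b x y : V} (hau : G.Adj a u)
    (hub : G.Adj u b) (hab : G.Adj a b) (hxy : G.Adj x y)
    (hx : x ≠ u ∧ x ≠ a ∧ x ≠ b) (hy : y ≠ u ∧ y ≠ a ∧ y ≠ b) :
    θ a u x + θ u b x - θ a b x = θ a u y + θ u b y - θ a b y := by
  have h1 := hθ.square hau hxy hx.2.1.symm hy.2.1.symm hx.1.symm hy.1.symm
  have h2 := hθ.square hub hxy hx.1.symm hy.1.symm hx.2.2.symm hy.2.2.symm
  have h3 := hθ.square hab hxy hx.2.1.symm hy.2.1.symm hx.2.2.symm hy.2.2.symm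
  linear_combination h3 - h1 - h2

end IsWindingSystem

/-- Any function that is constant along the edges of `G - F` is constant off `F`. -/
def ConnectedOff {V : Type} (G : SimpleGraph V) (F : V → Prop) : Prop :=
  ∀ (f : V → ℂ), (∀ x y, ¬ F x → ¬ F y → G.Adj x y → f x = f y) →
    ∀ x y, ¬ F x → ¬ F y → f x = f y

/-- If the vertex `u` is the hub of a wheel all of whose triangles `u c c'` are nonseparating,
then in a plane drawing `u` has no neighbour outside the rim. -/
theorem PlaneEmbedding.not_adj_of_wheel {V : Type} {G : SimpleGraph V} (E : PlaneEmbedding G)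
    {u v : V} {c : ℕ → V} {m : ℕ} (hm : 3 ≤ m) (hclosed : c m = c 0)
    (hspoke : ∀ i ≤ m, G.Adj u (c i)) (hrim : ∀ i < m, G.Adj (c i) (c (i + 1)))
    (h1 : ∀ i, 2 ≤ i → i ≤ m → c 1 ≠ c i) (h02 : c 0 ≠ c 2) (hv : ∀ i ≤ m, v ≠ c i)
    (hconn : ∀ i < m, ConnectedOff G (fun x => x = u ∨ x = c i ∨ x = c (i + 1))) :
    ¬ G.Adj u v := by
  intro huv
  obtain ⟨z, θ, hθ⟩ := E.exists_isWindingSystem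
  have hu : ∀ i ≤ m, u ≠ c i := fun i hi => (hspoke i hi).ne
  let w : ℕ → V → ℂ := fun i x => θ (c i) u x + θ u (c (i + 1)) x - θ (c i) (c (i + 1)) x
  have hw : ∀ i < m, ∀ x, x ≠ u → x ≠ c i → x ≠ c (i + 1) → w i x = w i v := by
    intro i hi x hx1 hx2 hx3
    refine hconn i hi (w i) (fun x y hx hy hxy => ?_) x v (by tauto)
      (by have := huv.ne'; have := hv i hi.le; have := hv (i + 1) hi; tauto)
    exact hθ.triangle_eq (hspoke i hi.le).symm (hspoke (i + 1) hi) (hrim i hi) hxy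
      (by tauto) (by tauto)
  have hwsum : ∀ p q x, p ≤ q → q ≤ m → ∑ i ∈ Finset.Ico p q, w i x =
      θ (c p) u x - θ (c q) u x - ∑ i ∈ Finset.Ico p q, θ (c i) (c (i + 1)) x := by
    intro p q x hpq hq
    induction q, hpq using Nat.le_induction with
    | base => simp
    | succ q hpq ih =>
      rw [Finset.sum_Ico_succ_top hpq, Finset.sum_Ico_succ_top hpq, ih (by omega)]
      simp only [w]
      rw [hθ.symm (a := c (q + 1)) (b := u) x (hspoke (q + 1) hq).ne']
      ring
  have hsplit : ∀ f : ℕ → ℂ, ∑ i ∈ Finset.Ico 0 m, f i =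
      f 0 + (f 1 + ∑ i ∈ Finset.Ico 2 m, f i) := fun f => by
    rw [Finset.sum_eq_sum_Ico_succ_bot (by omega), Finset.sum_eq_sum_Ico_succ_bot (by omega)]
  have hrimv := hθ.sum_square (Nat.zero_le m) huv (fun i _ h => hrim i h)
    (fun i _ h => hu i h) (fun i _ h => hv i h)
  have hR := hθ.sum_square (p := 2) (q := m) (by omega) (hspoke 1 (by omega))
    (fun i _ h => hrim i h) (fun i _ h => hu i h) h1
  have hC := hθ.exp_sum (x := u) (Nat.zero_le m) (fun i _ h => hrim i h) (fun i _ h => hu i h)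
  have hB := hθ.exp_sum (x := c 1) (p := 2) (q := m) (by omega) (fun i _ h => hrim i h) h1
  have hwv := hwsum 0 m v (Nat.zero_le m) le_rfl
  have hw1 := hwsum 2 m (c 1) (by omega) le_rfl
  have hwR : ∑ i ∈ Finset.Ico 2 m, w i (c 1) = ∑ i ∈ Finset.Ico 2 m, w i v := by
    refine Finset.sum_congr rfl fun i hi => ?_
    rw [Finset.mem_Ico] at hi
    exact hw i hi.2 _ (hu 1 (by omega)).symm (h1 i hi.1 hi.2.le) (h1 (i + 1) (by omega) hi.2)
  have r01 : G.Adj (c 0) (c 1) := hrim 0 (by omega)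
  have r12 : G.Adj (c 1) (c 2) := hrim 1 (by omega)
  have hw0 := hw 0 (by omega) (c 2) (hu 2 (by omega)).symm h02.symm r12.ne'
  have hw1' := hw 1 (by omega) (c 0) (hu 0 (by omega)).symm r01.ne h02
  rw [hsplit] at hwv hC hrimv
  rw [hsplit] at hwv hrimv
  rw [hclosed] at hwv hC hrimv hR hB hw1
  simp only [w, Nat.reduceAdd, zero_add] at hwv hC hrimv hR hB hw1 hwR hw0 hw1'
  have q1 := hθ.square r01 (hspoke 2 (by omega)) (hu 0 (by omega)).symm h02
    (hu 1 (by omega)).symm r12.ne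
  have q2 := hθ.square r12 (hspoke 0 (by omega)) (hu 1 (by omega)).symm r01.ne'
    (hu 2 (by omega)).symm h02.symm
  have key : θ (c 0) (c 1) u + (θ (c 1) (c 2) u + ∑ i ∈ Finset.Ico 2 m, θ (c i) (c (i + 1)) u) =
      θ (c 0) (c 1) (c 2) + θ (c 1) (c 2) (c 0)
        + ∑ i ∈ Finset.Ico 2 m, θ (c i) (c (i + 1)) (c 1) := by
    have s0 := hθ.symm (a := u) (b := c 0) (c 1) (hu 0 (by omega))
    have s0' := hθ.symm (a := u) (b := c 0) (c 2) (hu 0 (by omega))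
    have s1 := hθ.symm (a := u) (b := c 1) (c 0) (hu 1 (by omega))
    have s2 := hθ.symm (a := u) (b := c 2) (c 1) (hu 2 (by omega))
    rw [s0'] at hw0
    rw [s1] at hw1'
    rw [s2, s0] at hw1
    linear_combination (1 / 2) * (hw0 + hw1' + hwR + hwv + hrimv - hw1 - q1 - q2 + hR)
  have e := congrArg Complex.exp key
  rw [hC, Complex.exp_add, Complex.exp_add, hB, hθ.exp_eq r01 h02.symm r12.ne',
    hθ.exp_eq r12 r01.ne h02] at e
  have n1 : z (c 0) - z u ≠ 0 := sub_ne_zero.2 fun h => hu 0 (by omega) (hθ.inj h).symm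
  have n2 : z (c 0) - z (c 2) ≠ 0 := sub_ne_zero.2 fun h => h02 (hθ.inj h)
  have n3 : z (c 0) - z (c 1) ≠ 0 := sub_ne_zero.2 fun h => r01.ne (hθ.inj h)
  have n4 : z (c 1) - z (c 2) ≠ 0 := sub_ne_zero.2 fun h => r12.ne (hθ.inj h)
  have n3' : z (c 1) - z (c 0) ≠ 0 := sub_ne_zero.2 fun h => r01.ne' (hθ.inj h)
  have n4' : z (c 2) - z (c 1) ≠ 0 := sub_ne_zero.2 fun h => r12.ne' (hθ.inj h)
  rw [div_self n1] at e
  have e' : (1 : ℂ) = -1 := by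
    refine e.trans ?_
    field_simp
    ring
  norm_num at e'

theorem ConnectedOff.mono {V : Type} {G H : SimpleGraph V} {F : V → Prop} (h : ConnectedOff G F)
    (hGH : G ≤ H) : ConnectedOff H F :=
  fun f hf => h f fun x y hx hy hxy => hf x y hx hy (hGH hxy)

theorem SimpleGraph.exists_adj_of_induce_connected {V : Type*} {G : SimpleGraph V} {X : Set V}
    (h : (G.induce X).Connected) (A : Set V) {x y : V} (hx : x ∈ X) (hxA : x ∈ A) (hy : y ∈ X)
    (hyA : y ∉ A) : ∃ u ∈ X, ∃ v ∈ X, u ∈ A ∧ v ∉ A ∧ G.Adj u v := by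
  obtain ⟨w⟩ := h.preconnected ⟨x, hx⟩ ⟨y, hy⟩
  obtain ⟨d, -, h1, h2⟩ := w.exists_boundary_dart {z | (z : V) ∈ A} hxA hyA
  exact ⟨d.fst, d.fst.2, d.snd, d.snd.2, h1, h2, d.adj⟩

namespace OctahedralTower

/-! ### The triangulation -/

/-- The rows of a block: two triangles `S`, `T` forming an octahedron and, for each `a : Fin 3`,
two triangles `X a`, `P a` nested in the face of that octahedron opposite to `S a`. -/
inductive Row
  | S
  | T
  | X (a : Fin 3)
  | P (a : Fin 3)
  deriving DecidableEq

namespace Row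

/-- The list of all rows. -/
def all : List Row := [S, T, X 0, X 1, X 2, P 0, P 1, P 2]

instance : Fintype Row where
  elems := ⟨all, by decide⟩
  complete r := by
    rcases r with _ | _ | a | a
    · decide
    · decide
    · revert a; decide
    · revert a; decide

theorem sum_univ (f : Row → ℕ) :
    ∑ r, f r = f S + f T + ∑ a, (f (X a) + f (P a)) := by
  change f S + (f T + (f (X 0) + (f (X 1) + (f (X 2) + (f (P 0) + (f (P 1) + (f (P 2) + 0)))))))
    = _
  rw [Fin.sum_univ_three]
  ring

end Row

open Row

/-- A vertex of a block is a row together with a colour. -/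
abbrev Node : Type := Row × Fin 3

/-- Compatibility of the rows of adjacent vertices of different colours in a block. -/
def rowAdj : Node → Node → Bool
  | (S, _), (S, _) => true
  | (S, _), (T, _) => true
  | (T, _), (S, _) => true
  | (T, _), (T, _) => true
  | (S, i), (X a, _) => i ≠ a
  | (X a, _), (S, i) => i ≠ a
  | (T, i), (X a, _) => i = a
  | (X a, _), (T, i) => i = a
  | (X a, _), (X b, _) => a = b
  | (X a, _), (P b, _) => a = b
  | (P a, _), (X b, _) => a = b
  | (P a, _), (P b, _) => a = b
  | _, _ => false

/-- Adjacency inside a block. -/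
def blockAdj (p q : Node) : Bool := p.2 ≠ q.2 && rowAdj p q

/-- Adjacency between the outer triangle of a block and the inner triangle of the next one. -/
def linkAdj (p q : Node) : Bool := p.1 = T && q.1 = S && p.2 ≠ q.2

theorem rowAdj_comm (p q : Node) : rowAdj p q = rowAdj q p := by
  rcases p with ⟨_ | _ | a | a, i⟩ <;> rcases q with ⟨_ | _ | b | b, j⟩ <;>
    simp [rowAdj, eq_comm]

theorem blockAdj_comm (p q : Node) : blockAdj p q = blockAdj q p := by
  rw [blockAdj, blockAdj, rowAdj_comm]
  simp [eq_comm]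

/-- The octahedral tower: `k` blocks, consecutive ones joined by an octahedral layer. -/
def tower (k : ℕ) : SimpleGraph (Fin k × Node) where
  Adj x y := ((x.1 : ℕ) = y.1 ∧ blockAdj x.2 y.2) ∨ ((x.1 : ℕ) + 1 = y.1 ∧ linkAdj x.2 y.2) ∨
    ((y.1 : ℕ) + 1 = x.1 ∧ linkAdj y.2 x.2)
  symm := ⟨by
    rintro x y (⟨h, h'⟩ | ⟨h, h'⟩ | ⟨h, h'⟩)
    · exact Or.inl ⟨h.symm, by rwa [blockAdj_comm]⟩
    · exact Or.inr (Or.inr ⟨h, h'⟩)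
    · exact Or.inr (Or.inl ⟨h, h'⟩)⟩
  loopless := ⟨by
    rintro x (⟨-, h⟩ | ⟨h, -⟩ | ⟨h, -⟩)
    · simp [blockAdj] at h
    · omega
    · omega⟩

theorem tower_adj {k : ℕ} {x y : Fin k × Node} : (tower k).Adj x y ↔
    ((x.1 : ℕ) = y.1 ∧ blockAdj x.2 y.2) ∨ ((x.1 : ℕ) + 1 = y.1 ∧ linkAdj x.2 y.2) ∨
    ((y.1 : ℕ) + 1 = x.1 ∧ linkAdj y.2 x.2) := Iff.rfl

theorem card_tower (k : ℕ) : Fintype.card (Fin k × Node) = 24 * k := by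
  have h : Fintype.card Row = 8 := rfl
  simp only [Fintype.card_prod, Fintype.card_fin, h]
  ring

/-! ### Degrees -/

theorem ncard_fiber {k : ℕ} (m : Fin k) (P : Node → Bool) :
    {y : Fin k × Node | y.1 = m ∧ P y.2}.ncard = (Finset.univ.filter fun q => P q).card := by
  have : {y : Fin k × Node | y.1 = m ∧ P y.2} =
      Prod.mk m '' (Finset.univ.filter fun q => P q : Finset Node) := by
    ext ⟨a, b⟩
    simp only [Set.mem_ofPred_eq, Finset.coe_filter, Finset.mem_univ, true_and, Set.mem_image,
      Prod.mk.injEq]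
    exact ⟨fun h => ⟨b, h.2, h.1.symm, rfl⟩, fun ⟨c, h, h', h''⟩ => ⟨h'.symm, h'' ▸ h⟩⟩
  rw [this, Set.ncard_image_of_injective _ (Prod.mk_right_injective m), Set.ncard_coe_finset]

theorem even_ncard_fiber {k : ℕ} (m : ℕ) (P : Node → Bool)
    (hP : Even (Finset.univ.filter fun q => P q).card) :
    Even {y : Fin k × Node | (y.1 : ℕ) = m ∧ P y.2}.ncard := by
  by_cases hm : m < k
  · have := ncard_fiber (⟨m, hm⟩ : Fin k) P
    simp only [Fin.ext_iff] at this
    rwa [this]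
  · have : {y : Fin k × Node | (y.1 : ℕ) = m ∧ P y.2} = ∅ := by
      ext ⟨a, b⟩
      simp
      omega
    simp [this]

theorem isEulerian_tower (k : ℕ) : IsEulerian (tower k) := by
  rintro ⟨n, p⟩
  have hblock : ∀ p : Node, Even (Finset.univ.filter fun q => blockAdj p q).card := by decide
  have hup : ∀ p : Node, Even (Finset.univ.filter fun q => linkAdj p q).card := by decide
  have hdown : ∀ p : Node, Even (Finset.univ.filter fun q => linkAdj q p).card := by decide
  have hsplit : (tower k).neighborSet (n, p) =
      ({y | (y.1 : ℕ) = n ∧ blockAdj p y.2} ∪ {y | (y.1 : ℕ) = n + 1 ∧ linkAdj p y.2}) ∪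
        {y | (y.1 : ℕ) + 1 = n ∧ linkAdj y.2 p} := by
    ext y
    simp only [SimpleGraph.mem_neighborSet, tower_adj, Set.mem_union, Set.mem_ofPred_eq]
    rw [eq_comm, eq_comm (a := (n : ℕ) + 1)]
    tauto
  rw [hsplit, Set.ncard_union_eq, Set.ncard_union_eq]
  · refine ((even_ncard_fiber _ _ (hblock p)).add (even_ncard_fiber _ _ (hup p))).add ?_
    rcases Nat.eq_zero_or_pos (n : ℕ) with h | h
    · have : {y : Fin k × Node | (y.1 : ℕ) + 1 = n ∧ linkAdj y.2 p} = ∅ := by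
        ext y
        simp
        omega
      simp [this]
    · have := even_ncard_fiber (k := k) (n - 1) (fun q => linkAdj q p) (hdown p)
      have heq : {y : Fin k × Node | (y.1 : ℕ) + 1 = n ∧ linkAdj y.2 p} =
          {y | (y.1 : ℕ) = n - 1 ∧ linkAdj y.2 p} := by
        ext y
        have : (y.1 : ℕ) + 1 = n ↔ (y.1 : ℕ) = n - 1 := by omega
        simp only [Set.mem_ofPred_eq, this]
      rwa [heq]
  · rw [Set.disjoint_left]
    rintro y ⟨h, -⟩ ⟨h', -⟩
    omega
  · rw [Set.disjoint_left]
    rintro y (⟨h, -⟩ | ⟨h, -⟩) ⟨h', -⟩ <;> omega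

/-! ### Straight-line drawing -/

/-- The linear combination of two integer points with integer coefficients. -/
def combination (x y : ℤ) (p q : ℤ × ℤ) : ℤ × ℤ := (x * p.1 + y * q.1, x * p.2 + y * q.2)

/-- The corners of the reference triangle. -/
def corner : Fin 3 → ℤ × ℤ
  | 0 => (1, 0)
  | 1 => (0, 1)
  | 2 => (-1, -1)

/-- Position of a vertex of a block. -/
def pos : Node → ℤ × ℤ
  | (S, j) => combination 48 0 (corner j) (corner j)
  | (T, j) => combination (-192) 0 (corner j) (corner j)
  | (X a, j) => if j = a then combination (-52) 0 (corner a) (corner a)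
      else combination (-100) (-12) (corner a) (corner j)
  | (P a, j) => if j = a then combination (-87) 0 (corner a) (corner a)
      else combination (-75) 3 (corner a) (corner j)

/-- The list of all vertices of a block. -/
def nodes : List Node := Row.all.product [0, 1, 2]

/-- The segments drawn for a block and for the layer joining it to the previous block, in the
coordinates of the block; inside the block, they are directed towards the larger colour. -/
def blockSegments : List ((ℤ × ℤ) × (ℤ × ℤ)) :=
  ((nodes.product nodes).filter fun e => decide (e.1.2 < e.2.2) && blockAdj e.1 e.2).map
    (fun e => (pos e.1, pos e.2)) ++
  ((nodes.product nodes).filter fun e => linkAdj e.1 e.2).map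
    (fun e => (combination (-12) 0 (corner e.1.2) (corner e.1.2), pos e.2))

/-- Twice the signed area of a triangle. -/
def orientation (a b c : ℤ × ℤ) : ℤ := (b.1 - a.1) * (c.2 - a.2) - (b.2 - a.2) * (c.1 - a.1)

/-- The line through `a` and `b` witnesses that the segments `ab` and `cd` only meet in common
endpoints. -/
def lineSeparates (a b c d : ℤ × ℤ) : Bool :=
  decide (0 < orientation a b c * orientation a b d) ||
  (decide (c = a ∨ c = b) && decide (orientation a b d ≠ 0)) ||
  (decide (d = a ∨ d = b) && decide (orientation a b c ≠ 0))

theorem mem_nodes (p : Node) : p ∈ nodes := by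
  revert p; decide

set_option maxRecDepth 100000 in
theorem blockSegments_separated : (blockSegments.all fun e => blockSegments.all fun f =>
    decide (e = f) || decide (e = f.swap) || lineSeparates e.1 e.2 f.1 f.2 ||
      lineSeparates f.1 f.2 e.1 e.2) = true := by
  decide +kernel

/-- The linear functionals, with thresholds, used to separate different blocks. -/
def walls : List ((ℤ × ℤ) × ℤ) :=
  [((2, -1), 100), ((-1, 2), 100), ((-1, -1), 100), ((-2, 1), 24), ((1, -2), 24), ((1, 1), 24)]

/-- The value of the functional of a wall at an integer point. -/
def wallValue (w : (ℤ × ℤ) × ℤ) (p : ℤ × ℤ) : ℤ := w.1.1 * p.1 + w.1.2 * p.2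

theorem walls_pos : ∀ w ∈ walls, 0 < w.2 := by decide

theorem blockSegments_beyond_wall : ∀ e ∈ blockSegments, ∃ w ∈ walls,
    w.2 ≤ wallValue w e.1 ∧ w.2 ≤ wallValue w e.2 ∧
      (w.2 < wallValue w e.1 ∨ w.2 < wallValue w e.2) := by
  decide +kernel

theorem blockSegments_before_wall : ∀ e ∈ blockSegments, ∀ w ∈ walls,
    wallValue w e.1 ≤ 16 * w.2 ∧ wallValue w e.2 ≤ 16 * w.2 ∧
      (wallValue w e.1 < 16 * w.2 ∨ wallValue w e.2 < 16 * w.2) := by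
  decide +kernel

theorem pos_beyond_wall : ∀ p, ∃ w ∈ walls, w.2 < wallValue w (pos p) := by
  decide +kernel

theorem pos_before_wall : ∀ p, ∀ w ∈ walls, wallValue w (pos p) ≤ 16 * w.2 := by
  decide +kernel

theorem pos_injective : Function.Injective pos := by
  have : ∀ p q, pos p = pos q → p = q := by decide +kernel
  exact fun p q => this p q

/-- An integer point as a point of the plane. -/
def realPoint (p : ℤ × ℤ) : ℝ × ℝ := (p.1, p.2)

theorem realPoint_injective : Function.Injective realPoint := by
  intro p q h
  simpa [realPoint, Prod.ext_iff] using h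

/-- The linear functional with coefficients `c`. -/
def functional (c z : ℝ × ℝ) : ℝ := c.1 * z.1 + c.2 * z.2

theorem functional_combination (c : ℝ × ℝ) (s t : ℝ) (a b : ℝ × ℝ) :
    functional c (s • a + t • b) = s * functional c a + t * functional c b := by
  simp only [functional, Prod.fst_add, Prod.snd_add, Prod.smul_fst, Prod.smul_snd, smul_eq_mul]
  ring

theorem functional_smul (c : ℝ × ℝ) (s : ℝ) (a : ℝ × ℝ) :
    functional c (s • a) = s * functional c a := by
  simp only [functional, Prod.smul_fst, Prod.smul_snd, smul_eq_mul]
  ring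

/-- A point of a segment at which a functional attains its maximum `κ` is an endpoint, unless the
functional is constantly `κ`. -/
theorem eq_endpoint_of_functional_le {a b z c : ℝ × ℝ} {κ : ℝ} (hz : z ∈ segment ℝ a b)
    (hκ : κ ≤ functional c z) (ha : functional c a ≤ κ) (hb : functional c b ≤ κ)
    (hab : functional c a < κ ∨ functional c b < κ) :
    (z = a ∧ functional c a = κ) ∨ (z = b ∧ functional c b = κ) := by
  obtain ⟨s, t, hs, ht, hst, rfl⟩ := hz
  rw [functional_combination] at hκ
  have hκ' : s * (κ - functional c a) + t * (κ - functional c b) ≤ 0 := by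
    linear_combination hκ + κ * hst
  have hsa := mul_nonneg hs (sub_nonneg.2 ha)
  have htb := mul_nonneg ht (sub_nonneg.2 hb)
  rcases hab with h | h
  · have : s = 0 := by
      rcases mul_eq_zero.1 (le_antisymm (by linarith) hsa) with h | h <;> linarith
    subst this
    have : t = 1 := by linarith
    subst this
    exact Or.inr ⟨by simp, by linarith⟩
  · have : t = 0 := by
      rcases mul_eq_zero.1 (le_antisymm (by linarith) htb) with h | h <;> linarith
    subst this
    have : s = 1 := by linarith
    subst this
    exact Or.inl ⟨by simp, by linarith⟩

theorem functional_neg (c z : ℝ × ℝ) : functional (-c) z = -functional c z := by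
  simp [functional]
  ring

theorem eq_endpoint_of_le_functional {a b z c : ℝ × ℝ} {κ : ℝ} (hz : z ∈ segment ℝ a b)
    (hκ : functional c z ≤ κ) (ha : κ ≤ functional c a) (hb : κ ≤ functional c b)
    (hab : κ < functional c a ∨ κ < functional c b) :
    (z = a ∧ functional c a = κ) ∨ (z = b ∧ functional c b = κ) := by
  have := eq_endpoint_of_functional_le (c := -c) (κ := -κ) hz
  simp only [functional_neg, neg_le_neg_iff, neg_lt_neg_iff, neg_inj] at this
  exact this hκ ha hb hab

theorem functional_le_of_mem_segment {a b z c : ℝ × ℝ} {κ : ℝ} (hz : z ∈ segment ℝ a b)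
    (ha : functional c a ≤ κ) (hb : functional c b ≤ κ) : functional c z ≤ κ := by
  obtain ⟨s, t, hs, ht, hst, rfl⟩ := hz
  rw [functional_combination]
  have : κ = s * κ + t * κ := by rw [← add_mul, hst, one_mul]
  rw [this]
  gcongr

theorem le_functional_of_mem_segment {a b z c : ℝ × ℝ} {κ : ℝ} (hz : z ∈ segment ℝ a b)
    (ha : κ ≤ functional c a) (hb : κ ≤ functional c b) : κ ≤ functional c z := by
  have := functional_le_of_mem_segment (c := -c) (κ := -κ) hz
  simp only [functional_neg, neg_le_neg_iff] at this
  exact this ha hb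

/-- Two segments on different sides of a line, neither of them contained in it, only meet in
common endpoints. -/
theorem segment_inter_subset_of_functional {a b a' b' c : ℝ × ℝ} {κ : ℝ}
    (ha : functional c a ≤ κ) (hb : functional c b ≤ κ)
    (hab : functional c a < κ ∨ functional c b < κ)
    (ha' : κ ≤ functional c a') (hb' : κ ≤ functional c b')
    (hab' : κ < functional c a' ∨ κ < functional c b') :
    segment ℝ a b ∩ segment ℝ a' b' ⊆ {a, b} ∩ {a', b'} := by
  rintro z ⟨hz, hz'⟩
  have h := eq_endpoint_of_functional_le hz (le_functional_of_mem_segment hz' ha' hb') ha hb hab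
  have h' := eq_endpoint_of_le_functional hz' (functional_le_of_mem_segment hz ha hb) ha' hb' hab'
  exact ⟨h.imp And.left And.left, h'.imp And.left And.left⟩

/-- The functional vanishing in the direction of the segment `ab`. -/
def normal (a b : ℤ × ℤ) : ℝ × ℝ := (-((b.2 : ℝ) - a.2), (b.1 : ℝ) - a.1)

theorem functional_normal (a b c : ℤ × ℤ) : functional (normal a b) (realPoint c) =
    functional (normal a b) (realPoint a) + orientation a b c := by
  simp only [functional, normal, realPoint, orientation]
  push_cast
  ring

theorem segment_inter_subset_of_lineSeparates {a b c d : ℤ × ℤ} (h : lineSeparates a b c d) :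
    segment ℝ (realPoint a) (realPoint b) ∩ segment ℝ (realPoint c) (realPoint d) ⊆
      {realPoint a, realPoint b} ∩ {realPoint c, realPoint d} := by
  rintro z ⟨hz, hz'⟩
  have hb : functional (normal a b) (realPoint b) = functional (normal a b) (realPoint a) := by
    rw [functional_normal a b b, orientation]
    push_cast
    ring
  have hle := functional_le_of_mem_segment hz le_rfl hb.le
  have hge := le_functional_of_mem_segment hz le_rfl hb.ge
  have hc := functional_normal a b c
  have hd := functional_normal a b d
  set κ := functional (normal a b) (realPoint a)
  have onLine : ∀ p : ℤ × ℤ, p = a ∨ p = b → functional (normal a b) (realPoint p) = κ := by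
    rintro p (rfl | rfl)
    · rfl
    · exact hb
  have key : ∀ p q : ℤ × ℤ, z ∈ segment ℝ (realPoint p) (realPoint q) → p = a ∨ p = b →
      orientation a b q ≠ 0 → z = realPoint p ∧ (z = realPoint a ∨ z = realPoint b) := by
    intro p q hz' hp hq
    have hq' := functional_normal a b q
    have hzp : z = realPoint p := by
      rcases lt_or_gt_of_ne hq with h | h
      · have h0 : (orientation a b q : ℝ) < 0 := by exact_mod_cast h
        rcases eq_endpoint_of_functional_le hz' hge (onLine p hp).le (by linarith)
          (Or.inr (by linarith)) with h | h
        · exact h.1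
        · exact absurd h.2 (by linarith)
      · have h0 : (0 : ℝ) < orientation a b q := by exact_mod_cast h
        rcases eq_endpoint_of_le_functional hz' hle (onLine p hp).ge (by linarith)
          (Or.inr (by linarith)) with h | h
        · exact h.1
        · exact absurd h.2 (by linarith)
    refine ⟨hzp, ?_⟩
    rcases hp with rfl | rfl
    · exact Or.inl hzp
    · exact Or.inr hzp
  simp only [lineSeparates, Bool.or_eq_true, Bool.and_eq_true, decide_eq_true_eq] at h
  rcases h with (h | ⟨h, h'⟩) | ⟨h, h'⟩
  · exfalso
    rcases pos_and_pos_or_neg_and_neg_of_mul_pos h with ⟨h1, h2⟩ | ⟨h1, h2⟩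
    · have h1' : (0 : ℝ) < orientation a b c := by exact_mod_cast h1
      have h2' : (0 : ℝ) < orientation a b d := by exact_mod_cast h2
      rcases eq_endpoint_of_le_functional hz' hle (by linarith) (by linarith)
          (Or.inr (by linarith)) with h | h <;> linarith [h.2]
    · have h1' : (orientation a b c : ℝ) < 0 := by exact_mod_cast h1
      have h2' : (orientation a b d : ℝ) < 0 := by exact_mod_cast h2
      rcases eq_endpoint_of_functional_le hz' hge (by linarith) (by linarith)
          (Or.inr (by linarith)) with h | h <;> linarith [h.2]
  · obtain ⟨h1, h2⟩ := key c d hz' h h'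
    exact ⟨h2, Or.inl h1⟩
  · obtain ⟨h1, h2⟩ := key d c (by rwa [segment_symm]) h h'
    exact ⟨h2, Or.inr h1⟩

/-- `x` and `y` are the endpoints of a segment drawn for the block `n`. -/
def IsLevelSegment (n : ℕ) (x y : ℝ × ℝ) : Prop := ∃ e ∈ blockSegments,
  x = (16 : ℝ) ^ n • realPoint e.1 ∧ y = (16 : ℝ) ^ n • realPoint e.2

theorem exists_mem_segment_of_smul {r : ℝ} {a b z : ℝ × ℝ} (hz : z ∈ segment ℝ (r • a) (r • b)) :
    ∃ w ∈ segment ℝ a b, z = r • w := by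
  obtain ⟨s, t, hs, ht, hst, rfl⟩ := hz
  exact ⟨s • a + t • b, ⟨s, t, hs, ht, hst, rfl⟩, by module⟩

theorem IsLevelSegment.inter_subset_of_eq {n : ℕ} {x y x' y' : ℝ × ℝ} (h : IsLevelSegment n x y)
    (h' : IsLevelSegment n x' y') (hne : ¬ (x = x' ∧ y = y')) (hne' : ¬ (x = y' ∧ y = x')) :
    segment ℝ x y ∩ segment ℝ x' y' ⊆ {x, y} ∩ {x', y'} := by
  obtain ⟨e, he, rfl, rfl⟩ := h
  obtain ⟨f, hf, rfl, rfl⟩ := h'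
  rintro z ⟨hz, hz'⟩
  obtain ⟨w, hw, rfl⟩ := exists_mem_segment_of_smul hz
  obtain ⟨w', hw', hww⟩ := exists_mem_segment_of_smul hz'
  obtain rfl : w = w' := smul_right_injective _ (by positivity) hww
  have hsep := blockSegments_separated
  simp only [List.all_eq_true] at hsep
  have hsep := hsep e he f hf
  simp only [Bool.or_eq_true, decide_eq_true_eq] at hsep
  have hw : w ∈ ({realPoint e.1, realPoint e.2} : Set (ℝ × ℝ)) ∩ {realPoint f.1, realPoint f.2} := by
    rcases hsep with ((rfl | rfl) | h) | h
    · exact absurd ⟨rfl, rfl⟩ hne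
    · exact absurd ⟨rfl, rfl⟩ hne'
    · exact segment_inter_subset_of_lineSeparates h ⟨hw, hw'⟩
    · exact (segment_inter_subset_of_lineSeparates h ⟨hw', hw⟩).symm
  rcases hw with ⟨h1, h2⟩
  exact ⟨h1.imp (congrArg _) (congrArg _), h2.imp (congrArg _) (congrArg _)⟩

theorem functional_realPoint (w : (ℤ × ℤ) × ℤ) (p : ℤ × ℤ) :
    functional (realPoint w.1) (realPoint p) = wallValue w p := by
  simp [functional, realPoint, wallValue]

theorem wall_scale {n m : ℕ} (h : n < m) {w : (ℤ × ℤ) × ℤ} (hw : w ∈ walls) :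
    (16 : ℝ) ^ n * (16 * w.2) ≤ 16 ^ m * w.2 := by
  have hw : (0 : ℝ) < w.2 := by exact_mod_cast walls_pos w hw
  calc (16 : ℝ) ^ n * (16 * w.2) = 16 ^ (n + 1) * w.2 := by ring
    _ ≤ 16 ^ m * w.2 := by
      gcongr
      · norm_num
      · omega

theorem IsLevelSegment.inter_subset_of_lt {n m : ℕ} (hnm : n < m) {x y x' y' : ℝ × ℝ}
    (h : IsLevelSegment n x y) (h' : IsLevelSegment m x' y') :
    segment ℝ x y ∩ segment ℝ x' y' ⊆ {x, y} ∩ {x', y'} := by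
  obtain ⟨e, he, rfl, rfl⟩ := h
  obtain ⟨f, hf, rfl, rfl⟩ := h'
  obtain ⟨w, hw, h1, h2, h3⟩ := blockSegments_beyond_wall f hf
  obtain ⟨k1, k2, k3⟩ := blockSegments_before_wall e he w hw
  have hs := wall_scale hnm hw
  apply segment_inter_subset_of_functional (c := realPoint w.1) (κ := 16 ^ m * w.2) <;>
    simp only [functional_smul, functional_realPoint]
  · refine le_trans ?_ hs
    gcongr
    exact_mod_cast k1
  · refine le_trans ?_ hs
    gcongr
    exact_mod_cast k2
  · refine k3.imp (fun k => lt_of_lt_of_le ?_ hs) (fun k => lt_of_lt_of_le ?_ hs) <;>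
    · gcongr
      exact_mod_cast k
  · gcongr
  · gcongr
  · refine h3.imp (fun k => ?_) (fun k => ?_) <;> gcongr

/-- Position of a vertex of the tower in the plane. -/
def towerPos {k : ℕ} (x : Fin k × Node) : ℝ × ℝ := (16 : ℝ) ^ (x.1 : ℕ) • realPoint (pos x.2)

theorem towerPos_ne_of_lt {k : ℕ} {x y : Fin k × Node} (h : x.1 < y.1) :
    towerPos x ≠ towerPos y := by
  obtain ⟨w, hw, h1⟩ := pos_beyond_wall y.2
  have h2 := pos_before_wall x.2 w hw
  have hs := wall_scale (Fin.lt_def.1 h) hw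
  intro heq
  have := congrArg (functional (realPoint w.1)) heq
  simp only [towerPos, functional_smul, functional_realPoint] at this
  have h1' : (16 : ℝ) ^ (y.1 : ℕ) * w.2 < 16 ^ (y.1 : ℕ) * wallValue w (pos y.2) := by
    gcongr
  have h2' : (16 : ℝ) ^ (x.1 : ℕ) * wallValue w (pos x.2) ≤ 16 ^ (x.1 : ℕ) * (16 * w.2) := by
    gcongr
    exact_mod_cast h2
  linarith

theorem towerPos_injective (k : ℕ) : Function.Injective (towerPos (k := k)) := by
  intro x y h
  rcases lt_trichotomy x.1 y.1 with hlt | heq | hlt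
  · exact absurd h (towerPos_ne_of_lt hlt)
  · have : realPoint (pos x.2) = realPoint (pos y.2) := by
      rw [towerPos, towerPos, heq] at h
      exact smul_right_injective _ (by positivity) h
    exact Prod.ext heq (pos_injective (realPoint_injective this))
  · exact absurd h.symm (towerPos_ne_of_lt hlt)

theorem isLevelSegment_of_blockAdj {k : ℕ} {x y : Fin k × Node} (h : (x.1 : ℕ) = y.1)
    (hxy : blockAdj x.2 y.2) (hlt : x.2.2 < y.2.2) :
    IsLevelSegment y.1 (towerPos x) (towerPos y) := by
  refine ⟨(pos x.2, pos y.2), ?_, by rw [towerPos, h], rfl⟩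
  refine List.mem_append_left _ (List.mem_map.2 ⟨(x.2, y.2), List.mem_filter.2 ⟨?_, ?_⟩, rfl⟩)
  · exact List.mem_product.2 ⟨mem_nodes _, mem_nodes _⟩
  · simp [hlt, hxy]

theorem isLevelSegment_of_linkAdj {k : ℕ} {x y : Fin k × Node} (h : (x.1 : ℕ) + 1 = y.1)
    (hxy : linkAdj x.2 y.2) : IsLevelSegment y.1 (towerPos x) (towerPos y) := by
  refine ⟨(combination (-12) 0 (corner x.2.2) (corner x.2.2), pos y.2), ?_, ?_, rfl⟩
  · refine List.mem_append_right _
      (List.mem_map.2 ⟨(x.2, y.2), List.mem_filter.2 ⟨?_, hxy⟩, rfl⟩)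
    exact List.mem_product.2 ⟨mem_nodes _, mem_nodes _⟩
  · have hx : x.2 = (T, x.2.2) := by
      simp only [linkAdj, Bool.and_eq_true, decide_eq_true_eq] at hxy
      exact Prod.ext hxy.1.1 rfl
    rw [towerPos, ← h, hx]
    simp only [pos, combination, realPoint, Prod.smul_mk, smul_eq_mul, pow_succ]
    push_cast
    ext <;> simp <;> ring

theorem exists_isLevelSegment {k : ℕ} {x y : Fin k × Node} (h : (tower k).Adj x y) :
    ∃ n, IsLevelSegment n (towerPos x) (towerPos y) ∨ IsLevelSegment n (towerPos y) (towerPos x) := by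
  rcases h with ⟨h, h'⟩ | ⟨h, h'⟩ | ⟨h, h'⟩
  · have hne : x.2.2 ≠ y.2.2 := by
      simp only [blockAdj, Bool.and_eq_true, decide_eq_true_eq] at h'
      exact h'.1
    rcases lt_or_gt_of_ne hne with hlt | hlt
    · exact ⟨_, Or.inl (isLevelSegment_of_blockAdj h h' hlt)⟩
    · exact ⟨_, Or.inr (isLevelSegment_of_blockAdj h.symm (by rwa [blockAdj_comm]) hlt)⟩
  · exact ⟨_, Or.inl (isLevelSegment_of_linkAdj h h')⟩
  · exact ⟨_, Or.inr (isLevelSegment_of_linkAdj h h')⟩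

theorem tower_segment_inter_subset {k : ℕ} {u v a b : Fin k × Node} (h₁ : (tower k).Adj u v)
    (h₂ : (tower k).Adj a b) (hne : s(u, v) ≠ s(a, b)) :
    segment ℝ (towerPos u) (towerPos v) ∩ segment ℝ (towerPos a) (towerPos b) ⊆
      {towerPos u, towerPos v} ∩ {towerPos a, towerPos b} := by
  have key : ∀ (u v a b : Fin k × Node), s(u, v) ≠ s(a, b) → ∀ n m,
      IsLevelSegment n (towerPos u) (towerPos v) → IsLevelSegment m (towerPos a) (towerPos b) →
      segment ℝ (towerPos u) (towerPos v) ∩ segment ℝ (towerPos a) (towerPos b) ⊆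
        {towerPos u, towerPos v} ∩ {towerPos a, towerPos b} := by
    intro u v a b hne n m h h'
    rcases lt_trichotomy n m with hlt | rfl | hlt
    · exact h.inter_subset_of_lt hlt h'
    · refine h.inter_subset_of_eq h' ?_ ?_
      · rintro ⟨h1, h2⟩
        exact hne (by rw [towerPos_injective k h1, towerPos_injective k h2])
      · rintro ⟨h1, h2⟩
        exact hne (by rw [towerPos_injective k h1, towerPos_injective k h2, Sym2.eq_swap])
    · rw [Set.inter_comm, Set.inter_comm {towerPos u, towerPos v}]
      exact h'.inter_subset_of_lt hlt h
  obtain ⟨n, h | h⟩ := exists_isLevelSegment h₁ <;>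
    obtain ⟨m, h' | h'⟩ := exists_isLevelSegment h₂
  · exact key u v a b hne n m h h'
  · rw [segment_symm ℝ (towerPos a), Set.pair_comm (towerPos a)]
    exact key u v b a (by rwa [Sym2.eq_swap (a := b)]) n m h h'
  · rw [segment_symm ℝ (towerPos u), Set.pair_comm (towerPos u)]
    exact key v u a b (by rwa [Sym2.eq_swap (a := v)]) n m h h'
  · rw [segment_symm ℝ (towerPos u), Set.pair_comm (towerPos u), segment_symm ℝ (towerPos a),
      Set.pair_comm (towerPos a)]
    exact key v u b a (by rwa [Sym2.eq_swap (a := v), Sym2.eq_swap (a := b)]) n m h h'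

theorem exists_adj_tower {k : ℕ} (x : Fin k × Node) : ∃ y, (tower k).Adj x y := by
  have : ∀ p : Node, ∃ q, blockAdj p q := by decide
  obtain ⟨q, hq⟩ := this x.2
  exact ⟨(x.1, q), Or.inl ⟨rfl, hq⟩⟩

/-- The straight-line drawing of the tower. -/
def towerEmbedding (k : ℕ) : PlaneEmbedding (tower k) where
  vtx := towerPos
  vtx_inj := towerPos_injective k
  arc u v _ := segment ℝ (towerPos u) (towerPos v)
  arc_symm u v _ := segment_symm ..
  arc_path u v h := ⟨Path.segment _ _,
    Path.segment_injective_of_ne ((towerPos_injective k).ne h.ne), Path.range_segment _ _⟩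
  arc_vtx u v h w hw := by
    obtain ⟨y, hy⟩ := exists_adj_tower w
    by_cases hs : s(u, v) = s(w, y)
    · exact Sym2.mem_iff.1 (hs ▸ Sym2.mem_mk_left w y)
    · have := (tower_segment_inter_subset h hy hs ⟨hw, left_mem_segment ..⟩).1
      exact this.imp (fun h => towerPos_injective k h) (fun h => towerPos_injective k h)
  arc_inter u v a b h₁ h₂ hne := tower_segment_inter_subset h₁ h₂ hne

/-! ### Connected dominating sets of the tower -/

section LowerBound

variable {k : ℕ} {X : Finset (Fin k × Node)}

theorem exists_mem_of_isDomSet (hX : IsDomSet (tower k) X) (n : Fin k) (a j : Fin 3) :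
    ∃ q, (q = (P a, j) ∨ blockAdj q (P a, j)) ∧ (n, q) ∈ X := by
  rcases hX (n, (P a, j)) with h | ⟨⟨m, q⟩, hu, ⟨h, h'⟩ | ⟨-, h⟩ | ⟨-, h⟩⟩
  · exact ⟨_, Or.inl rfl, h⟩
  · obtain rfl : m = n := Fin.ext h
    exact ⟨q, Or.inr h', hu⟩
  · simp [linkAdj] at h
  · simp [linkAdj] at h

/-- Membership in the two triangles nested in a face of a block. -/
def inCap (a : Fin 3) (p : Node) : Bool := p.1 = Row.X a || p.1 = P a

theorem exists_mem_cap (hX : IsDomSet (tower k) X) (n : Fin k) (a : Fin 3) :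
    ∃ q, inCap a q ∧ (n, q) ∈ X := by
  obtain ⟨q, hq, h⟩ := exists_mem_of_isDomSet hX n a 0
  have : ∀ (a : Fin 3) (q : Node), q = (P a, 0) ∨ blockAdj q (P a, 0) → inCap a q := by decide
  exact ⟨q, this a q hq, h⟩

theorem exists_mem_cap_adj (hX : IsConnDomSet (tower k) X) (n : Fin k) (a : Fin 3) :
    ∃ m, (n, (Row.X a, m)) ∈ X ∧ ((n, (T, a)) ∈ X ∨ (n, (S, a + 1)) ∈ X ∨ (n, (S, a + 2)) ∈ X) := by
  obtain ⟨p, hp, hpX⟩ := exists_mem_cap hX.1 n a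
  obtain ⟨q, hq, hqX⟩ := exists_mem_cap hX.1 n (a + 1)
  have hdisj : ∀ (a : Fin 3) (q : Node), inCap (a + 1) q → ¬ inCap a q := by decide
  obtain ⟨⟨m, u⟩, hu, ⟨m', v⟩, hv, ⟨h1, h2⟩, h3, h4⟩ :=
    SimpleGraph.exists_adj_of_induce_connected hX.2 {x | x.1 = n ∧ inCap a x.2} hpX ⟨rfl, hp⟩ hqX
      (fun h => hdisj a q hq h.2)
  obtain rfl : m = n := h1
  have hedge : ∀ (a : Fin 3) (u v : Node), (inCap a u && !inCap a v && blockAdj u v) →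
      u.1 = Row.X a ∧ (v = (T, a) ∨ v = (S, a + 1) ∨ v = (S, a + 2)) := by decide +kernel
  have hlink : ∀ (a : Fin 3) (u v : Node), inCap a u → ¬ linkAdj u v ∧ ¬ linkAdj v u := by
    decide +kernel
  rcases h4 with ⟨h, h4⟩ | ⟨-, h4⟩ | ⟨-, h4⟩
  · obtain rfl : m = m' := Fin.ext h
    obtain ⟨h5, h6⟩ := hedge a u v (by
      simp only [Bool.and_eq_true, Bool.not_eq_true', Bool.eq_false_iff]
      exact ⟨⟨h2, fun h => h3 ⟨rfl, h⟩⟩, h4⟩)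
    refine ⟨u.2, h5 ▸ hu, ?_⟩
    rcases h6 with rfl | rfl | rfl
    · exact Or.inl hv
    · exact Or.inr (Or.inl hv)
    · exact Or.inr (Or.inr hv)
  · exact absurd h4 (hlink a u v h2).1
  · exact absurd h4 (hlink a u v h2).2

/-- A connected dominating set contains a vertex of the outer triangle of every block other than
the last one. -/
theorem exists_mem_outer (hX : IsConnDomSet (tower k) X) {n : Fin k} (hn : (n : ℕ) + 1 < k) :
    ∃ j, (n, (T, j)) ∈ X := by
  obtain ⟨p, -, hpX⟩ := exists_mem_cap hX.1 n 0
  obtain ⟨q, -, hqX⟩ := exists_mem_cap hX.1 ⟨n + 1, hn⟩ 0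
  obtain ⟨⟨m, u⟩, hu, ⟨m', v⟩, hv, h1, h2, h3⟩ :=
    SimpleGraph.exists_adj_of_induce_connected hX.2 {x | x.1 ≤ n} hpX (le_refl n) hqX
      (fun h => by
        have : (n : ℕ) + 1 ≤ n := h
        omega)
  simp only [Set.mem_ofPred_eq, Fin.le_def] at h1 h2
  rcases h3 with ⟨h, -⟩ | ⟨h, h3⟩ | ⟨h, -⟩
  · dsimp only at h
    omega
  · simp only [linkAdj, Bool.and_eq_true, decide_eq_true_eq] at h h3
    obtain rfl : m = n := Fin.ext (by omega)
    exact ⟨u.2, h3.1.1 ▸ hu⟩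
  · dsimp only at h
    omega

/-- A connected dominating set does not meet the two triangles of a block in an antipodal pair
only. -/
theorem exists_mem_of_antipodal (hX : IsConnDomSet (tower k) X) {n : Fin k} {a : Fin 3}
    (hs : (n, (S, a)) ∈ X) (ht : (n, (T, a)) ∈ X) :
    ∃ b, b ≠ a ∧ ((n, (S, b)) ∈ X ∨ (n, (T, b)) ∈ X) := by
  by_contra! hcon
  let D : Node → Bool := fun p => p = (S, a) || inCap (a + 1) p || inCap (a + 2) p
  obtain ⟨⟨m, u⟩, hu, ⟨m', v⟩, hv, h1, h2, h3⟩ :=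
    SimpleGraph.exists_adj_of_induce_connected hX.2 {x | x.1 < n ∨ (x.1 = n ∧ D x.2)} hs
      (Or.inr ⟨rfl, by simp [D]⟩) ht (by simp [D, inCap])
  have hedge : ∀ (a : Fin 3) (u v : Node),
      (u = (S, a) || inCap (a + 1) u || inCap (a + 2) u) →
      ¬ (v = (S, a) || inCap (a + 1) v || inCap (a + 2) v) → blockAdj u v →
      ∃ b, b ≠ a ∧ (v = (S, b) ∨ v = (T, b)) := by decide +kernel
  have hlink : ∀ (a : Fin 3) (u v : Node),
      (u = (S, a) || inCap (a + 1) u || inCap (a + 2) u) → ¬ linkAdj u v := by decide +kernel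
  have hout : ∀ b, b ≠ a → ¬ (v = (S, b) ∨ v = (T, b)) ∨ m' ≠ n := by
    intro b hb
    by_contra! h
    obtain ⟨rfl | rfl, rfl⟩ := h
    · exact (hcon b hb).1 hv
    · exact (hcon b hb).2 hv
  simp only [Set.mem_ofPred_eq, Fin.lt_def, Fin.ext_iff] at h1 h2
  rcases h3 with ⟨h, h3⟩ | ⟨h, h3⟩ | ⟨h, h3⟩ <;> dsimp only at h h3
  · rcases h1 with h1 | ⟨h1, h1'⟩
    · exact h2 (Or.inl (by omega))
    · obtain ⟨b, hb, h4⟩ := hedge a u v h1' (fun h' => h2 (Or.inr ⟨by omega, h'⟩)) h3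
      rcases hout b hb with h5 | h5
      · exact h5 h4
      · exact h5 (Fin.ext (by omega))
  · rcases h1 with h1 | ⟨h1, h1'⟩
    · have hmn : m' = n := by
        refine Fin.ext (le_antisymm (by omega) ?_)
        by_contra! h4
        exact h2 (Or.inl h4)
      subst hmn
      simp only [linkAdj, Bool.and_eq_true, decide_eq_true_eq] at h3
      by_cases hva : v.2 = a
      · refine h2 (Or.inr ⟨rfl, ?_⟩)
        have : v = (S, a) := Prod.ext h3.1.2 hva
        simp [D, this]
      · rcases hout v.2 hva with h5 | h5
        · exact h5 (Or.inl (Prod.ext h3.1.2 rfl))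
        · exact h5 rfl
    · exact hlink a u v h1' h3
  · exact h2 (Or.inl (by omega))

/-- Membership in `X` of the vertices of a block. -/
def blockTrace (X : Finset (Fin k × Node)) (n : Fin k) (p : Node) : Bool := decide ((n, p) ∈ X)

theorem two_le_cap_count (hX : IsConnDomSet (tower k) X) (n : Fin k) (a : Fin 3) :
    2 ≤ ∑ j, ((blockTrace X n (Row.X a, j)).toNat + (blockTrace X n (P a, j)).toNat) := by
  have key : ∀ x p : Fin 3 → Bool, (∃ m, x m) →
      (∀ j, p 0 || p 1 || p 2 || x (j + 1) || x (j + 2)) →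
      2 ≤ ∑ j, ((x j).toNat + (p j).toNat) := by decide +kernel
  refine key (fun j => blockTrace X n (Row.X a, j)) (fun j => blockTrace X n (P a, j)) ?_ fun j => ?_
  · obtain ⟨m, hm, -⟩ := exists_mem_cap_adj hX n a
    exact ⟨m, decide_eq_true hm⟩
  · obtain ⟨q, hq, hqX⟩ := exists_mem_of_isDomSet hX.1 n a j
    have hnbr : ∀ (a j : Fin 3) (q : Node), q = (P a, j) ∨ blockAdj q (P a, j) →
        q = (P a, 0) ∨ q = (P a, 1) ∨ q = (P a, 2) ∨ q = (Row.X a, j + 1) ∨ q = (Row.X a, j + 2) := by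
      decide +kernel
    rcases hnbr a j q hq with rfl | rfl | rfl | rfl | rfl <;> simp [blockTrace, hqX]

theorem two_le_base_count (hX : IsConnDomSet (tower k) X) (n : Fin k) :
    2 ≤ ∑ j, ((blockTrace X n (S, j)).toNat + (blockTrace X n (T, j)).toNat) := by
  have key : ∀ s t : Fin 3 → Bool, (∀ a, t a || s (a + 1) || s (a + 2)) →
      2 ≤ ∑ j, ((s j).toNat + (t j).toNat) := by decide +kernel
  refine key (fun j => blockTrace X n (S, j)) (fun j => blockTrace X n (T, j)) fun a => ?_
  obtain ⟨m, -, h⟩ := exists_mem_cap_adj hX n a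
  simpa [blockTrace, or_assoc] using h

theorem three_le_base_count (hX : IsConnDomSet (tower k) X) {n : Fin k} (hn : (n : ℕ) + 1 < k) :
    3 ≤ ∑ j, ((blockTrace X n (S, j)).toNat + (blockTrace X n (T, j)).toNat) := by
  have key : ∀ s t : Fin 3 → Bool, (∀ a, t a || s (a + 1) || s (a + 2)) → (∃ j, t j) →
      (∀ a, (s a && t a) → ∃ b, b ≠ a ∧ (s b || t b)) →
      3 ≤ ∑ j, ((s j).toNat + (t j).toNat) := by decide +kernel
  refine key (fun j => blockTrace X n (S, j)) (fun j => blockTrace X n (T, j)) (fun a => ?_) ?_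
    fun a => ?_
  · obtain ⟨m, -, h⟩ := exists_mem_cap_adj hX n a
    simpa [blockTrace, or_assoc] using h
  · obtain ⟨j, hj⟩ := exists_mem_outer hX hn
    exact ⟨j, decide_eq_true hj⟩
  · simpa [blockTrace] using fun h h' => exists_mem_of_antipodal hX h h'

theorem card_eq_sum_blockTrace (X : Finset (Fin k × Node)) : X.card =
    ∑ n, (∑ j, ((blockTrace X n (S, j)).toNat + (blockTrace X n (T, j)).toNat) +
      ∑ a, ∑ j, ((blockTrace X n (Row.X a, j)).toNat + (blockTrace X n (P a, j)).toNat)) := by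
  have h : X.card = ∑ x, (decide (x ∈ X)).toNat := by
    simp [Bool.toNat, Bool.cond_decide]
  rw [h, Fintype.sum_prod_type]
  refine Finset.sum_congr rfl fun n _ => ?_
  rw [Fintype.sum_prod_type, Row.sum_univ]
  simp only [Finset.sum_add_distrib]
  rfl

/-- Every connected dominating set of the tower has at least `9k - 1` elements. -/
theorem le_card_of_isConnDomSet (hX : IsConnDomSet (tower k) X) : 9 * k - 1 ≤ X.card := by
  obtain _ | k := k
  · simp
  have hcap : ∀ n, 6 ≤ ∑ a, ∑ j,
      ((blockTrace X n (Row.X a, j)).toNat + (blockTrace X n (P a, j)).toNat) := fun n =>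
    (Finset.card_nsmul_le_sum Finset.univ _ 2 fun a _ => two_le_cap_count hX n a)
  rw [card_eq_sum_blockTrace, Fin.sum_univ_castSucc]
  have hlast := add_le_add (two_le_base_count hX (Fin.last k)) (hcap (Fin.last k))
  have hinit := Finset.card_nsmul_le_sum Finset.univ _ 9 fun (n : Fin k) _ =>
    add_le_add (three_le_base_count hX (n := n.castSucc) (by simp)) (hcap n.castSucc)
  simp only [Finset.card_univ, Fintype.card_fin, smul_eq_mul] at hinit
  omega

end LowerBound

/-! ### Links and facial triangles -/

/-- Search from the vertices in the first list, through the vertices in the second one; the result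
is `true` if everything is reached within the given number of steps. -/
def explore : ℕ → List Node → List Node → Bool
  | _, _, [] => true
  | 0, _, _ :: _ => false
  | _ + 1, [], _ :: _ => false
  | n + 1, p :: l, q :: r =>
    explore n ((q :: r).filter (blockAdj p) ++ l) ((q :: r).filter fun x => !blockAdj p x)

theorem eq_of_explore {f : Node → ℂ} {R : Node → Prop} {z : ℂ}
    (hf : ∀ p q, R p → R q → blockAdj p q → f p = f q) (n : ℕ) (l r : List Node)
    (hl : ∀ p ∈ l, R p ∧ f p = z) (hr : ∀ p ∈ r, R p) (h : explore n l r) : ∀ p ∈ r, f p = z := by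
  induction n generalizing l r with
  | zero =>
    rcases r with _ | ⟨q, r⟩
    · simp
    · simp [explore] at h
  | succ n ih =>
    rcases r with _ | ⟨q, r⟩
    · simp
    rcases l with _ | ⟨p, l⟩
    · simp [explore] at h
    have hp := hl p (by simp)
    have hnear : ∀ x ∈ q :: r, blockAdj p x → f x = z := fun x hx hpx => by
      rw [← hf p x hp.1 (hr x hx) hpx, hp.2]
    rw [explore] at h
    have hfar := ih _ _ (fun x hx => ?_) (fun x hx => hr x (List.mem_of_mem_filter hx)) h
    · intro x hx
      by_cases hpx : blockAdj p x
      · exact hnear x hx hpx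
      · exact hfar x (List.mem_filter.2 ⟨hx, by simpa using hpx⟩)
    · rcases List.mem_append.1 hx with hx | hx
      · obtain ⟨hx, hpx⟩ := List.mem_filter.1 hx
        exact ⟨hr x hx, hnear x hx hpx⟩
      · exact hl x (by simp [hx])

/-- The vertices of a block that are not removed induce a connected graph. -/
def blockConnected (removed : Node → Bool) : Bool :=
  match nodes.filter fun p => !removed p with
  | [] => true
  | p :: l => explore 24 [p] l

theorem eq_of_blockConnected {removed : Node → Bool} (h : blockConnected removed) {f : Node → ℂ}
    (hf : ∀ p q, ¬ removed p → ¬ removed q → blockAdj p q → f p = f q) (p q : Node)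
    (hp : ¬ removed p) (hq : ¬ removed q) : f p = f q := by
  have hmem : ∀ x, x ∈ (nodes.filter fun p => !removed p) ↔ ¬ removed x := fun x => by
    simp [mem_nodes]
  rw [blockConnected] at h
  rw [← hmem] at hp hq
  split at h
  · next heq => simp [heq] at hp
  · next x l heq =>
    rw [heq] at hp hq hmem
    have := eq_of_explore (z := f x) hf 24 [x] l (by simpa using (hmem x).1 (by simp))
      (fun y hy => (hmem y).1 (by simp [hy])) h
    have this : ∀ y ∈ x :: l, f y = f x := by simpa using this
    rw [this p hp, this q hq]

/-- A vertex relative to a block: the difference of the block numbers, and the vertex in its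
block. -/
abbrev RelNode : Type := ℤ × Node

/-- The vertices of the block at distance `d` that belong to a list. -/
def trace (F : List RelNode) (d : ℤ) (p : Node) : Bool := decide ((d, p) ∈ F)

/-- The layer between two consecutive blocks contains an edge avoiding `F`. -/
def layerConnected (F : List RelNode) (d : ℤ) : Bool :=
  decide (∃ a b : Fin 3, a ≠ b ∧ ¬ trace F d (T, a) ∧ ¬ trace F (d + 1) (S, b))

/-- The relative block number `d` exists, where `lo` and `hi` tell whether there are a previous and
a next block. -/
def inRange (lo hi : Bool) (d : ℤ) : Bool := d = 0 || (lo && d = -1) || (hi && d = 1)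

/-- The list `F` does not separate the tower. -/
def nonSeparating (lo hi : Bool) (F : List RelNode) : Bool :=
  blockConnected (trace F 0) &&
  (F.all fun x => decide (x.1 = 0) ||
    (inRange true true x.1 && blockConnected (trace F x.1))) &&
  (layerConnected F (-2) && layerConnected F 1 && (!lo || layerConnected F (-1)) &&
    (!hi || layerConnected F 0))

theorem inRange_of_nonSeparating {lo hi : Bool} {F : List RelNode} (h : nonSeparating lo hi F) :
    ∀ x ∈ F, x.1 = 0 ∨ x.1 = -1 ∨ x.1 = 1 := by
  simp only [nonSeparating, inRange, Bool.and_eq_true, List.all_eq_true, Bool.or_eq_true,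
    Bool.true_and, decide_eq_true_eq] at h
  intro x hx
  have := h.1.2 x hx
  tauto

theorem blockConnected_of_nonSeparating {lo hi : Bool} {F : List RelNode}
    (h : nonSeparating lo hi F) (d : ℤ) : blockConnected (trace F d) := by
  simp only [nonSeparating, Bool.and_eq_true, List.all_eq_true, Bool.or_eq_true,
    decide_eq_true_eq] at h
  by_cases hd : ∃ p, (d, p) ∈ F
  · obtain ⟨p, hp⟩ := hd
    rcases h.1.2 _ hp with h0 | h0
    · obtain rfl : d = 0 := h0
      exact h.1.1
    · exact h0.2
  · have : trace F d = fun _ => false := by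
      funext p
      simpa [trace] using fun hp => hd ⟨p, hp⟩
    rw [this]
    decide +kernel

theorem layerConnected_of_nonSeparating {lo hi : Bool} {F : List RelNode}
    (h : nonSeparating lo hi F) {d : ℤ} (hlo : d = -1 → lo) (hhi : d = 0 → hi) :
    layerConnected F d := by
  have hrange := inRange_of_nonSeparating h
  simp only [nonSeparating, Bool.and_eq_true, List.all_eq_true] at h
  by_cases hd : d = -2 ∨ d = -1 ∨ d = 0 ∨ d = 1
  · rcases hd with rfl | rfl | rfl | rfl
    · exact h.2.1.1.1
    · simpa [hlo rfl] using h.2.1.2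
    · simpa [hhi rfl] using h.2.2
    · exact h.2.1.1.2
  · have key : ∀ e p, e = d ∨ e = d + 1 → ¬ trace F e p := by
      intro e p he hp
      have := hrange _ (of_decide_eq_true hp)
      dsimp only at this
      omega
    rw [layerConnected, decide_eq_true_eq]
    exact ⟨0, 1, by decide, key _ _ (Or.inl rfl), key _ _ (Or.inr rfl)⟩

theorem connectedOff_tower {k : ℕ} {lo hi : Bool} {F : List RelNode} (h : nonSeparating lo hi F)
    (n : Fin k) (hlo : 0 < (n : ℕ) → lo) (hhi : (n : ℕ) + 1 < k → hi) :
    ConnectedOff (tower k) (fun x => ((x.1 : ℤ) - n, x.2) ∈ F) := by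
  intro f hf
  have hblock : ∀ (m : Fin k) (p q : Node), ((m : ℤ) - n, p) ∉ F → ((m : ℤ) - n, q) ∉ F →
      f (m, p) = f (m, q) := by
    intro m p q hp hq
    refine eq_of_blockConnected (blockConnected_of_nonSeparating h ((m : ℤ) - n))
      (f := fun p => f (m, p)) (fun p q hp hq hpq => ?_) p q (by simpa [trace]) (by simpa [trace])
    exact hf _ _ (by simpa [trace] using hp) (by simpa [trace] using hq) (Or.inl ⟨rfl, hpq⟩)
  have key : ∀ (d : ℕ) (m m' : Fin k) (p q : Node), (m' : ℕ) = m + d →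
      ((m : ℤ) - n, p) ∉ F → ((m' : ℤ) - n, q) ∉ F → f (m, p) = f (m', q) := by
    intro d
    induction d with
    | zero =>
      intro m m' p q hm hp hq
      obtain rfl : m' = m := Fin.ext hm
      exact hblock _ p q hp hq
    | succ d ih =>
      intro m m' p q hm hp hq
      let m'' : Fin k := ⟨m + d, by omega⟩
      have hm'' : ((m'' : ℕ) : ℤ) + 1 = m' := by simp only [m'', hm]; push_cast; ring
      have hlayer := layerConnected_of_nonSeparating h (d := (m'' : ℤ) - n)
        (fun h => hlo (by omega)) (fun h => hhi (by omega))
      simp only [layerConnected, trace, decide_eq_true_eq] at hlayer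
      obtain ⟨a, b, hab, ha, hb⟩ := hlayer
      rw [show (m'' : ℤ) - n + 1 = m' - n by omega] at hb
      rw [ih m m'' p (T, a) rfl hp ha, hblock m' q (S, b) hq hb]
      exact hf _ _ ha hb (Or.inr (Or.inl ⟨by dsimp only; omega, by simp [linkAdj, hab]⟩))
  rintro ⟨m, p⟩ ⟨m', q⟩ hp hq
  rcases le_total (m : ℕ) m' with hm | hm
  · exact key (m' - m) m m' p q (by omega) hp hq
  · exact (key (m - m') m' m q p (by omega) hq hp).symm

/-- The vertex of colour `m` of the face of a block into which the row `X a` is inserted. -/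
def faceNode (a m : Fin 3) : Node := if m = a then (T, m) else (S, m)

/-- The link of a vertex in cyclic order; `lo` and `hi` tell whether there are a previous and a next
block. -/
def linkCycle (lo hi : Bool) : Node → List RelNode
  | (P a, i) => [(0, P a, i + 1), (0, P a, i + 2), (0, Row.X a, i + 1), (0, Row.X a, i + 2)]
  | (Row.X a, i) => [(0, P a, i + 1), (0, Row.X a, i + 2), (0, faceNode a (i + 1)),
      (0, faceNode a (i + 2)), (0, Row.X a, i + 1), (0, P a, i + 2)]
  | (S, i) => [(0, S, i + 1), (0, Row.X (i + 2), i + 2), (0, Row.X (i + 2), i + 1), (0, T, i + 2),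
      (0, T, i + 1), (0, Row.X (i + 1), i + 2), (0, Row.X (i + 1), i + 1), (0, S, i + 2)] ++
      if lo then [(-1, T, i + 1), (-1, T, i + 2)] else []
  | (T, i) => [(0, T, i + 2), (0, S, i + 1), (0, Row.X i, i + 2), (0, Row.X i, i + 1), (0, S, i + 2),
      (0, T, i + 1)] ++ if hi then [(1, S, i + 2), (1, S, i + 1)] else []

/-- Adjacency of relative vertices. -/
def relAdj (x y : RelNode) : Bool :=
  (x.1 = y.1 && blockAdj x.2 y.2) || (x.1 + 1 = y.1 && linkAdj x.2 y.2) ||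
    (y.1 + 1 = x.1 && linkAdj y.2 x.2)

/-- Periodic enumeration of a list. -/
def cyclicGet (L : List RelNode) (i : ℕ) : RelNode := L.getD (i % L.length) (0, S, 0)

/-- `L` is a cycle in the neighbourhood of `p` whose triangles with `p` are not separating. -/
def isLink (lo hi : Bool) (p : Node) (L : List RelNode) : Bool :=
  decide (3 ≤ L.length) && decide (cyclicGet L 0 ≠ cyclicGet L 2) &&
  (List.range L.length).all fun i =>
    inRange lo hi (cyclicGet L i).1 && relAdj (0, p) (cyclicGet L i) &&
    relAdj (cyclicGet L i) (cyclicGet L (i + 1)) &&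
    (decide (i = 1) || decide (cyclicGet L 1 ≠ cyclicGet L i)) &&
    nonSeparating lo hi [(0, p), cyclicGet L i, cyclicGet L (i + 1)]

set_option maxRecDepth 100000 in
theorem isLink_linkCycle : ∀ lo hi p, isLink lo hi p (linkCycle lo hi p) = true := by
  decide +kernel

/-- The vertex of the tower at a given position relative to the block `n`. -/
def RelNode.toTower {k : ℕ} (n : Fin k) (x : RelNode) : Fin k × Node :=
  (if h : ((n : ℤ) + x.1).toNat < k then ⟨((n : ℤ) + x.1).toNat, h⟩ else n, x.2)

theorem RelNode.eq_toTower_iff {k : ℕ} {n : Fin k} {x : RelNode} (h₀ : 0 ≤ (n : ℤ) + x.1)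
    (h₁ : (n : ℤ) + x.1 < k) (y : Fin k × Node) :
    y = x.toTower n ↔ ((y.1 : ℤ) - n, y.2) = x := by
  have h : ((n : ℤ) + x.1).toNat < k := by omega
  simp only [toTower, h, dite_true, Prod.ext_iff, Fin.ext_iff]
  refine and_congr_left fun _ => ?_
  omega

theorem tower_adj_of_relAdj {k : ℕ} {n : Fin k} {x y : Fin k × Node}
    (h : relAdj ((x.1 : ℤ) - n, x.2) ((y.1 : ℤ) - n, y.2)) : (tower k).Adj x y := by
  simp only [relAdj, Bool.or_eq_true, Bool.and_eq_true, decide_eq_true_eq, or_assoc] at h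
  refine h.imp (And.imp_left fun h => ?_) (Or.imp (And.imp_left fun h => ?_)
    (And.imp_left fun h => ?_)) <;> omega

/-- The tower is edge-maximal among planar graphs. -/
theorem not_adj_of_tower_le {k : ℕ} {H : SimpleGraph (Fin k × Node)} (hH : tower k ≤ H)
    (E : PlaneEmbedding H) {u v : Fin k × Node} (huv : ¬ (tower k).Adj u v) : ¬ H.Adj u v := by
  obtain ⟨n, p⟩ := u
  set lo : Bool := decide (0 < (n : ℕ))
  set hi : Bool := decide ((n : ℕ) + 1 < k)
  set L := linkCycle lo hi p
  have hL : isLink lo hi p L := isLink_linkCycle lo hi p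
  simp only [isLink, Bool.and_eq_true, Bool.or_eq_true, List.all_eq_true, List.mem_range,
    decide_eq_true_eq] at hL
  obtain ⟨⟨hm, h02⟩, hL⟩ := hL
  have hmod : ∀ i, cyclicGet L i = cyclicGet L (i % L.length) := fun i => by
    rw [cyclicGet, cyclicGet, Nat.mod_mod]
  have hmod_lt : ∀ i, i % L.length < L.length := fun i => Nat.mod_lt _ (by omega)
  have hrange : ∀ d, inRange lo hi d → 0 ≤ (n : ℤ) + d ∧ (n : ℤ) + d < k := by
    intro d hd
    simp only [inRange, lo, hi, Bool.or_eq_true, Bool.and_eq_true, decide_eq_true_eq] at hd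
    omega
  have hvalid : ∀ i, inRange lo hi (cyclicGet L i).1 := fun i => by
    rw [hmod]
    exact (hL _ (hmod_lt i)).1.1.1.1
  let c : ℕ → Fin k × Node := fun i => (cyclicGet L i).toTower n
  have hc_iff : ∀ i y, y = c i ↔ ((y.1 : ℤ) - n, y.2) = cyclicGet L i := fun i y =>
    RelNode.eq_toTower_iff (hrange _ (hvalid i)).1 (hrange _ (hvalid i)).2 y
  have hc : ∀ i, (((c i).1 : ℤ) - n, (c i).2) = cyclicGet L i := fun i => (hc_iff i _).1 rfl
  have hu_iff : ∀ y : Fin k × Node, y = (n, p) ↔ ((y.1 : ℤ) - n, y.2) = (0, p) := fun y => by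
    simp only [Prod.ext_iff, Fin.ext_iff]
    refine and_congr_left fun _ => ?_
    omega
  have hspoke : ∀ i, (tower k).Adj (n, p) (c i) := fun i => by
    refine tower_adj_of_relAdj (n := n) ?_
    rw [hc, hmod]
    simpa using (hL _ (hmod_lt i)).1.1.1.2
  have hne : ∀ {i j}, cyclicGet L i ≠ cyclicGet L j → c i ≠ c j := fun h h' =>
    h (by rw [← hc, ← hc, h'])
  refine E.not_adj_of_wheel (c := c) hm ?_ (fun i _ => hH (hspoke i)) (fun i him => hH ?_)
    (fun i h2 him => hne ?_) (hne h02) (fun i _ h => huv (h ▸ hspoke i)) fun i him => ?_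
  · simp only [c, cyclicGet, Nat.mod_self, Nat.zero_mod]
  · refine tower_adj_of_relAdj (n := n) ?_
    rw [hc, hc]
    exact (hL i him).1.1.2
  · rw [hmod i]
    refine (hL _ (hmod_lt i)).1.2.resolve_left ?_
    rcases him.lt_or_eq with him | rfl
    · rw [Nat.mod_eq_of_lt him]
      omega
    · simp
  · refine ConnectedOff.mono ?_ hH
    have := connectedOff_tower (hL i him).2 n (by simp [lo]) (by simp [hi])
    simpa only [List.mem_cons, List.not_mem_nil, or_false, ← hu_iff, ← hc_iff] using this

theorem isPlaneTriangulation_tower (k : ℕ) : IsPlaneTriangulation (tower k) := by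
  refine ⟨⟨towerEmbedding k⟩, fun u v huv hadj ⟨E⟩ => ?_⟩
  exact not_adj_of_tower_le le_sup_left E hadj (by simp [huv])

theorem connected_tower {k : ℕ} (hk : 0 < k) : (tower k).Connected := by
  have hoff := connectedOff_tower (F := []) (by decide +kernel) (⟨0, hk⟩ : Fin k) (lo := true)
    (hi := true) (fun _ => rfl) (fun _ => rfl)
  have : Nonempty (Fin k × Node) := ⟨(⟨0, hk⟩, (S, 0))⟩
  refine ⟨fun x y => ?_⟩
  classical
  have := hoff (fun z => if (tower k).Reachable x z then 1 else 0) (fun y z _ _ hyz => ?_) x y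
    (by simp) (by simp)
  · simpa using this
  · have : (tower k).Reachable x y ↔ (tower k).Reachable x z :=
      ⟨fun h => h.trans hyz.reachable, fun h => h.trans hyz.symm.reachable⟩
    simp [this]

theorem le_connDomNum_tower {k : ℕ} (hk : 0 < k) : 9 * k - 1 ≤ connDomNum (tower k) := by
  refine le_csInf ⟨_, Finset.univ, ⟨fun v => Or.inl (by simp), ?_⟩, rfl⟩ ?_
  · rw [Finset.coe_univ]
    exact (SimpleGraph.induceUnivIso (tower k)).connected_iff.2 (connected_tower hk)
  · rintro _ ⟨X, hX, rfl⟩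
    exact le_card_of_isConnDomSet hX

end OctahedralTower

/-- For every `k ≥ 2` there is an Eulerian plane triangulation of
order `24k` with connected domination number at least `9k − 1 = 3n/8 − 1`; consequently
it is false that every plane triangulation of order `n` has `γ_c ≤ n/3`. -/
theorem stmt15 :
    (∀ k : ℕ, 2 ≤ k →
      ∃ (V : Type) (inst : Fintype V) (G : SimpleGraph V) (_ : PlaneEmbedding G),
        IsPlaneTriangulation G ∧ IsEulerian G ∧
        @Fintype.card V inst = 24 * k ∧
        9 * k - 1 ≤ @connDomNum V inst G) ∧
    ¬ (∀ (V : Type) (inst : Fintype V) (G : SimpleGraph V),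
        IsPlaneTriangulation G →
        3 * @connDomNum V inst G ≤ @Fintype.card V inst) := by
  refine ⟨fun k hk => ⟨Fin k × OctahedralTower.Node, inferInstance, OctahedralTower.tower k,
    OctahedralTower.towerEmbedding k, OctahedralTower.isPlaneTriangulation_tower k,
    OctahedralTower.isEulerian_tower k, OctahedralTower.card_tower k,
    OctahedralTower.le_connDomNum_tower (by omega)⟩, fun h => ?_⟩
  have hle := h _ inferInstance _ (OctahedralTower.isPlaneTriangulation_tower 2)
  have hge := OctahedralTower.le_connDomNum_tower (k := 2) (by omega)
  have hcard := OctahedralTower.card_tower 2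
  omega
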